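/- arXiv:2605.12094 — 7 statements merged into one kernel-verified Lean document; each statement's English description precedes it below -/
import Mathlib

section
/- Let Ω be a finite nonempty type, r ∈ (0,1) a risk level, u : Ω → ℝ a utility, and μ a probability vector on Ω. Then the reward-side Conditional Value-at-Risk admits the finite-facet representation CVaR_r^μ(u) = max_{ω' ∈ Ω} ( u(ω') − (1/r) · Σ_ω μ(ω) · max(u(ω') − u(ω), 0) ). In particular the supremum defining CVaR_r^μ(u) is finite and attained. -/
open Finset

/-- If no value of `u` lies strictly between `b` and `t`, the expected shortfall is affine
on the segment joining them, with slope the mass of `{u ≤ b}`. -/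
lemma sum_mul_shortfall_eq {Ω : Type*} [Fintype Ω] (u μ : Ω → ℝ) {b t : ℝ}
    (hle : ∀ ω, u ω ≤ b → u ω ≤ t) (hlt : ∀ ω, b < u ω → t ≤ u ω) :
    ∑ ω, μ ω * max (t - u ω) 0
      = ∑ ω, μ ω * max (b - u ω) 0 + (t - b) * ∑ ω with u ω ≤ b, μ ω := by
  rw [Finset.sum_filter, Finset.mul_sum, ← Finset.sum_add_distrib]
  refine Finset.sum_congr rfl fun ω _ => ?_
  by_cases h : u ω ≤ b
  · rw [max_eq_left (sub_nonneg.2 (hle ω h)), max_eq_left (sub_nonneg.2 h), if_pos h]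
    ring
  · have h' := not_le.1 h
    rw [max_eq_right (sub_nonpos.2 (hlt ω h')), max_eq_right (sub_nonpos.2 h'.le), if_neg h]
    ring

/-- The CVaR objective at any level is dominated by its value at some level in the range
of `u`. -/
lemma exists_cvar_objective_le {Ω : Type*} [Fintype Ω] {r : ℝ} (hr : r ∈ Set.Ioo (0 : ℝ) 1)
    (u μ : Ω → ℝ) (hμ1 : ∑ ω, μ ω = 1) (b : ℝ) :
    ∃ ω', b - (1 / r) * ∑ ω, μ ω * max (b - u ω) 0
      ≤ u ω' - (1 / r) * ∑ ω, μ ω * max (u ω' - u ω) 0 := by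
  obtain ⟨hr0, hr1⟩ := hr
  suffices h : ∃ ω', (∀ ω, u ω ≤ b → u ω ≤ u ω') ∧ (∀ ω, b < u ω → u ω' ≤ u ω) ∧
      0 ≤ (u ω' - b) * (r - ∑ ω with u ω ≤ b, μ ω) by
    obtain ⟨ω', hle, hlt, h⟩ := h
    refine ⟨ω', ?_⟩
    rw [sum_mul_shortfall_eq u μ hle hlt, ← sub_nonneg]
    refine (div_nonneg h hr0.le).trans_eq ?_
    field_simp
    ring
  rcases le_or_gt (∑ ω with u ω ≤ b, μ ω) r with hm | hm
  · have hne : ({ω | b < u ω} : Finset Ω).Nonempty := by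
      by_contra hempty
      have hall : ({ω | u ω ≤ b} : Finset Ω) = Finset.univ := by
        simpa [Finset.filter_eq_empty_iff, Finset.filter_eq_self] using hempty
      rw [hall, hμ1] at hm
      exact hr1.not_ge hm
    obtain ⟨ω', hmem, hmin⟩ := Finset.exists_min_image _ u hne
    have hb : b < u ω' := by simpa using hmem
    exact ⟨ω', fun ω h => h.trans hb.le, fun ω h => hmin ω (by simpa using h),
      mul_nonneg (sub_nonneg.2 hb.le) (sub_nonneg.2 hm)⟩
  · have hne : ({ω | u ω ≤ b} : Finset Ω).Nonempty :=
      Finset.nonempty_of_sum_ne_zero (hr0.trans hm).ne'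
    obtain ⟨ω', hmem, hmax⟩ := Finset.exists_max_image _ u hne
    have hb : u ω' ≤ b := by simpa using hmem
    exact ⟨ω', fun ω h => hmax ω (by simpa using h), fun ω h => hb.trans h.le,
      mul_nonneg_of_nonpos_of_nonpos (sub_nonpos.2 hb) (sub_nonpos.2 hm.le)⟩

/-- **Finite-facet representation of reward-side CVaR.**
For a finite nonempty state space `Ω`, risk level `r ∈ (0,1)`, utility `u` and a
probability vector `μ`, the supremum defining
`CVaR_r^μ(u) := sup_{b ∈ ℝ} ( b − (1/r) · Σ_ω μ(ω) · max (b − u(ω)) 0 )`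
is finite and attained, and equals
`max_{ω'} ( u(ω') − (1/r) · Σ_ω μ(ω) · max (u(ω') − u(ω)) 0 )`. -/
theorem cvar_finite_facet_representation
    (Ω : Type*) [Fintype Ω] [Nonempty Ω]
    (r : ℝ) (hr : r ∈ Set.Ioo (0 : ℝ) 1)
    (u : Ω → ℝ) (μ : Ω → ℝ)
    (hμ0 : ∀ ω, 0 ≤ μ ω) (hμ1 : ∑ ω, μ ω = 1) :
    sSup (Set.range fun b : ℝ => b - (1 / r) * ∑ ω, μ ω * max (b - u ω) 0)
      = Finset.univ.sup' Finset.univ_nonempty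
          (fun ω' : Ω => u ω' - (1 / r) * ∑ ω, μ ω * max (u ω' - u ω) 0) ∧
    IsGreatest (Set.range fun b : ℝ => b - (1 / r) * ∑ ω, μ ω * max (b - u ω) 0)
      (Finset.univ.sup' Finset.univ_nonempty
        (fun ω' : Ω => u ω' - (1 / r) * ∑ ω, μ ω * max (u ω' - u ω) 0)) := by
  have hgreatest : IsGreatest
      (Set.range fun b : ℝ => b - (1 / r) * ∑ ω, μ ω * max (b - u ω) 0)
      (Finset.univ.sup' Finset.univ_nonempty
        (fun ω' : Ω => u ω' - (1 / r) * ∑ ω, μ ω * max (u ω' - u ω) 0)) := by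
    constructor
    · obtain ⟨ω', -, h⟩ := Finset.exists_mem_eq_sup' Finset.univ_nonempty
        (fun ω' : Ω => u ω' - (1 / r) * ∑ ω, μ ω * max (u ω' - u ω) 0)
      exact ⟨u ω', h.symm⟩
    · rintro _ ⟨b, rfl⟩
      obtain ⟨ω', h⟩ := exists_cvar_objective_le hr u μ hμ1 b
      exact h.trans (Finset.le_sup'
        (fun ω' : Ω => u ω' - (1 / r) * ∑ ω, μ ω * max (u ω' - u ω) 0) (Finset.mem_univ ω'))
  exact ⟨hgreatest.csSup_eq, hgreatest⟩
end

section
/- Let Ω be a finite state space, μ0 a prior with μ0(ω) > 0 for all ω, A a finite nonempty action set, ρ a max-affine risk value with finite nonempty index sets L_a and coefficient vectors c_{a,ℓ} : Ω → ℝ, and v : Ω × A → ℝ a sender payoff. For every incentive-compatible signaling scheme (S, π, α) there exists an incentive-compatible signaling scheme whose signal set is {(a,ℓ) : a ∈ A, ℓ ∈ L_a}, whose recommendation map sends (a,ℓ) to a, which has the same sender value, and such that every signal (a,ℓ) with positive probability has posterior μ_{(a,ℓ)} satisfying Σ_ω c_{a,ℓ}(ω) μ_{(a,ℓ)}(ω)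 ≥ Σ_ω c_{a',ℓ'}(ω) μ_{(a,ℓ)}(ω) for all a' ∈ A and ℓ' ∈ L_{a'}. -/
open Finset

variable {Ω A S : Type*}

/-- A signaling scheme: nonnegative signal probabilities summing to one in each state. -/
def IsScheme [Fintype S] (π : Ω → S → ℝ) : Prop :=
  (∀ ω s, 0 ≤ π ω s) ∧ ∀ ω, ∑ s, π ω s = 1

/-- Unconditional probability of signal `s` under prior `μ0` and scheme `π`. -/
def sigProb [Fintype Ω] (μ0 : Ω → ℝ) (π : Ω → S → ℝ) (s : S) : ℝ :=
  ∑ ω, μ0 ω * π ω s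

/-- Posterior belief after observing signal `s` (defined when `sigProb μ0 π s > 0`). -/
noncomputable def posterior [Fintype Ω] (μ0 : Ω → ℝ) (π : Ω → S → ℝ) (s : S) (ω : Ω) : ℝ :=
  μ0 ω * π ω s / sigProb μ0 π s

/-- Incentive compatibility: at every positive-probability signal, the recommended
action is a receiver best response under the risk value `ρ`. -/
def IC [Fintype Ω] (ρ : (Ω → ℝ) → A → ℝ) (μ0 : Ω → ℝ) (π : Ω → S → ℝ) (α : S → A) : Prop :=
  ∀ s, 0 < sigProb μ0 π s → ∀ a' : A, ρ (posterior μ0 π s) a' ≤ ρ (posterior μ0 π s) (α s)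

/-- Sender's expected value of a scheme with recommendation map `α`. -/
def senderValue [Fintype Ω] [Fintype S] (μ0 : Ω → ℝ) (π : Ω → S → ℝ) (α : S → A)
    (v : Ω → A → ℝ) : ℝ :=
  ∑ ω, ∑ s, μ0 ω * π ω s * v ω (α s)

/-- The receiver's max-affine risk value `ρ(μ,a) = max_{ℓ ∈ L a} Σ_ω c_{a,ℓ}(ω) μ(ω)`. -/
noncomputable def maxAffine [Fintype Ω] {L : A → Type*} [∀ a, Fintype (L a)]
    [∀ a, Nonempty (L a)] (c : (a : A) → L a → Ω → ℝ) (μ : Ω → ℝ) (a : A) : ℝ :=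
  Finset.univ.sup' Finset.univ_nonempty fun ℓ : L a => ∑ ω, c a ℓ ω * μ ω

/-- The scheme that reports `g s` whenever `π` would report `s`. -/
noncomputable def mergeSignals {T : Type*} [Fintype S] [DecidableEq T]
    (π : Ω → S → ℝ) (g : S → T) (ω : Ω) (t : T) : ℝ :=
  ∑ s with g s = t, π ω s

theorem sum_mergeSignals_mul {T : Type*} [Fintype S] [Fintype T] [DecidableEq T]
    (π : Ω → S → ℝ) (g : S → T) (ω : Ω) (h : T → ℝ) :
    ∑ t, mergeSignals π g ω t * h t = ∑ s, π ω s * h (g s) := by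
  rw [← Finset.sum_fiberwise univ g]
  refine sum_congr rfl fun t _ => ?_
  rw [mergeSignals, sum_mul]
  exact sum_congr rfl fun s hs => by rw [(mem_filter.mp hs).2]

theorem IsScheme.mergeSignals {T : Type*} [Fintype S] [Fintype T] [DecidableEq T]
    {π : Ω → S → ℝ} (hπ : IsScheme π) (g : S → T) : IsScheme (mergeSignals π g) :=
  ⟨fun ω _ => sum_nonneg fun s _ => hπ.1 ω s, fun ω => by
    simpa [hπ.2 ω] using sum_mergeSignals_mul π g ω fun _ => 1⟩

theorem senderValue_mergeSignals {T : Type*} [Fintype Ω] [Fintype S] [Fintype T] [DecidableEq T]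
    (μ0 : Ω → ℝ) (π : Ω → S → ℝ) (g : S → T) (β : T → A) (v : Ω → A → ℝ) :
    senderValue μ0 (mergeSignals π g) β v = senderValue μ0 π (fun s => β (g s)) v := by
  simp only [senderValue, mul_assoc, ← mul_sum]
  exact sum_congr rfl fun ω _ => by rw [sum_mergeSignals_mul π g ω fun t => v ω (β t)]

theorem sum_mul_posterior [Fintype Ω] (μ0 : Ω → ℝ) (π : Ω → S → ℝ) (s : S) (d : Ω → ℝ) :
    ∑ ω, d ω * posterior μ0 π s ω = (∑ ω, d ω * (μ0 ω * π ω s)) / sigProb μ0 π s := by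
  simp only [posterior, sum_div, mul_div_assoc]

theorem sum_mul_mergeSignals {T : Type*} [Fintype Ω] [Fintype S] [DecidableEq T]
    (μ0 : Ω → ℝ) (π : Ω → S → ℝ) (g : S → T) (t : T) (d : Ω → ℝ) :
    ∑ ω, d ω * (μ0 ω * mergeSignals π g ω t)
      = ∑ s with g s = t, ∑ ω, d ω * (μ0 ω * π ω s) := by
  simp only [mergeSignals, mul_sum]
  exact sum_comm

/-- At every signal of an incentive-compatible scheme, some facet of the recommended action
dominates all facets of all actions, against the joint weights of states with that signal. -/
theorem IC.exists_active_facet [Fintype Ω] [Fintype S] {L : A → Type*} [∀ a, Fintype (L a)]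
    [∀ a, Nonempty (L a)] {c : (a : A) → L a → Ω → ℝ} {μ0 : Ω → ℝ} (hμ0 : ∀ ω, 0 ≤ μ0 ω)
    {π : Ω → S → ℝ} {α : S → A} (hπ : IsScheme π) (hIC : IC (maxAffine c) μ0 π α) (s : S) :
    ∃ ℓ : L (α s), ∀ (a' : A) (ℓ' : L a'),
      ∑ ω, c a' ℓ' ω * (μ0 ω * π ω s) ≤ ∑ ω, c (α s) ℓ ω * (μ0 ω * π ω s) := by
  have hw : ∀ ω, 0 ≤ μ0 ω * π ω s := fun ω => mul_nonneg (hμ0 ω) (hπ.1 ω s)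
  have hP : 0 ≤ sigProb μ0 π s := sum_nonneg fun ω _ => hw ω
  rcases hP.eq_or_lt with h0 | hpos
  · have hz : ∀ ω, μ0 ω * π ω s = 0 := fun ω =>
      (sum_eq_zero_iff_of_nonneg fun ω _ => hw ω).mp h0.symm ω (mem_univ ω)
    exact ⟨Classical.arbitrary _, fun a' ℓ' => by simp [hz]⟩
  · obtain ⟨ℓ, -, hℓ⟩ := exists_mem_eq_sup' univ_nonempty
      fun ℓ : L (α s) => ∑ ω, c (α s) ℓ ω * posterior μ0 π s ω
    refine ⟨ℓ, fun a' ℓ' => ?_⟩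
    have h : ∑ ω, c a' ℓ' ω * posterior μ0 π s ω ≤ ∑ ω, c (α s) ℓ ω * posterior μ0 π s ω :=
      ((le_sup' (fun ℓ : L a' => ∑ ω, c a' ℓ ω * posterior μ0 π s ω) (mem_univ ℓ')).trans
        (hIC s hpos a')).trans_eq hℓ
    rwa [sum_mul_posterior, sum_mul_posterior, div_le_div_iff_of_pos_right hpos] at h

/-- Recommending `a` is incentive compatible when the reported facet of `a` is dominant. -/
theorem IC.of_active_facet [Fintype Ω] {L : A → Type*} [∀ a, Fintype (L a)]
    [∀ a, Nonempty (L a)] {c : (a : A) → L a → Ω → ℝ} {μ0 : Ω → ℝ}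
    {π : Ω → (Σ a : A, L a) → ℝ}
    (h : ∀ σ : Σ a : A, L a, 0 < sigProb μ0 π σ → ∀ (a' : A) (ℓ' : L a'),
      ∑ ω, c a' ℓ' ω * posterior μ0 π σ ω ≤ ∑ ω, c σ.1 σ.2 ω * posterior μ0 π σ ω) :
    IC (maxAffine c) μ0 π (fun σ => σ.1) := fun σ hσ a' =>
  sup'_le _ _ fun ℓ' _ => (h σ hσ a' ℓ').trans <|
    le_sup' (fun ℓ : L σ.1 => ∑ ω, c σ.1 ℓ ω * posterior μ0 π σ ω) (mem_univ σ.2)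

/-- **Active-facet revelation principle.** For every incentive-compatible scheme there is
an incentive-compatible scheme whose signals are action–facet pairs `(a,ℓ)`, whose
recommendation map is the first projection, with the same sender value, and such that at
every positive-probability signal `(a,ℓ)` the facet `ℓ` dominates all facets of all actions
at the induced posterior. -/
theorem active_facet_revelation
    (Ω A : Type*) [Fintype Ω] [Fintype A] [Nonempty A]
    (L : A → Type*) [∀ a, Fintype (L a)] [∀ a, Nonempty (L a)]
    (c : (a : A) → L a → Ω → ℝ)
    (μ0 : Ω → ℝ) (hμ0pos : ∀ ω, 0 < μ0 ω) (hμ0sum : ∑ ω, μ0 ω = 1)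
    (v : Ω → A → ℝ)
    (S : Type*) [Fintype S] (π : Ω → S → ℝ) (α : S → A)
    (hπ : IsScheme π) (hIC : IC (maxAffine c) μ0 π α) :
    ∃ π' : Ω → (Σ a : A, L a) → ℝ,
      IsScheme π' ∧
      IC (maxAffine c) μ0 π' (fun σ => σ.1) ∧
      senderValue μ0 π' (fun σ => σ.1) v = senderValue μ0 π α v ∧
      ∀ σ : Σ a : A, L a, 0 < sigProb μ0 π' σ →
        ∀ (a' : A) (ℓ' : L a'),
          ∑ ω, c a' ℓ' ω * posterior μ0 π' σ ω
            ≤ ∑ ω, c σ.1 σ.2 ω * posterior μ0 π' σ ω := by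
  classical
  choose f hf using hIC.exists_active_facet (fun ω => (hμ0pos ω).le) hπ
  let g : S → Σ a : A, L a := fun s => ⟨α s, f s⟩
  have hdom : ∀ σ : Σ a : A, L a, 0 < sigProb μ0 (mergeSignals π g) σ →
      ∀ (a' : A) (ℓ' : L a'),
        ∑ ω, c a' ℓ' ω * posterior μ0 (mergeSignals π g) σ ω
          ≤ ∑ ω, c σ.1 σ.2 ω * posterior μ0 (mergeSignals π g) σ ω := by
    intro σ hσ a' ℓ'
    rw [sum_mul_posterior, sum_mul_posterior, div_le_div_iff_of_pos_right hσ,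
      sum_mul_mergeSignals, sum_mul_mergeSignals]
    refine sum_le_sum fun s hs => ?_
    obtain rfl : g s = σ := (mem_filter.mp hs).2
    exact hf s a' ℓ'
  exact ⟨mergeSignals π g, hπ.mergeSignals g, .of_active_facet hdom,
    senderValue_mergeSignals μ0 π g _ v, hdom⟩
end

section
/- Let Ω be a finite state space, μ0 a prior with μ0(ω) > 0 for all ω, A a finite nonempty action set, ρ a max-affine risk value with index sets L_a and coefficients c_{a,ℓ}, and v : Ω × A → ℝ a sender payoff. Every active-facet LP solution q induces an incentive-compatible signaling scheme whose sender value equals the LP objective value of q: namely the scheme with signal set {(a,ℓ) : a ∈ A, ℓ ∈ L_a}, π(ω)((a,ℓ)) := q_{a,ℓ,ω} / μ0(ω), and recommendation (a,ℓ) ↦ a. -/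
open Finset

variable {Ω A S : Type*}

/-- Feasibility for the active-facet LP: nonnegative joint masses, Bayes plausibility,
and facet dominance for every pair of action–facet types. -/
def LPFeasible [Fintype Ω] [Fintype A] {L : A → Type*} [∀ a, Fintype (L a)]
    (c : (a : A) → L a → Ω → ℝ) (μ0 : Ω → ℝ) (q : (Σ a : A, L a) → Ω → ℝ) : Prop :=
  (∀ σ ω, 0 ≤ q σ ω) ∧
  (∀ ω, ∑ σ : Σ a : A, L a, q σ ω = μ0 ω) ∧
  (∀ σ σ' : Σ a : A, L a, 0 ≤ ∑ ω, q σ ω * (c σ.1 σ.2 ω - c σ'.1 σ'.2 ω))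

/-- Objective value of the active-facet LP. -/
def LPValue [Fintype Ω] [Fintype A] {L : A → Type*} [∀ a, Fintype (L a)]
    (v : Ω → A → ℝ) (q : (Σ a : A, L a) → Ω → ℝ) : ℝ :=
  ∑ σ : Σ a : A, L a, ∑ ω, q σ ω * v ω σ.1

/-- Facet dominance at the type `(a, ℓ)` makes `a` optimal at every belief proportional to the
joint mass `x` of that type, as every affine piece lies below the piece `(a, ℓ)` there. -/
theorem maxAffine_div_le_of_dominance [Fintype Ω] {L : A → Type*} [∀ a, Fintype (L a)]
    [∀ a, Nonempty (L a)] (c : (a : A) → L a → Ω → ℝ) (x : Ω → ℝ) {p : ℝ} (hp : 0 ≤ p)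
    (a : A) (ℓ : L a) (h : ∀ a' (ℓ' : L a'), 0 ≤ ∑ ω, x ω * (c a ℓ ω - c a' ℓ' ω)) (a' : A) :
    maxAffine c (fun ω => x ω / p) a' ≤ maxAffine c (fun ω => x ω / p) a := by
  refine Finset.sup'_le _ _ fun ℓ' _ => le_trans ?_
    (Finset.le_sup' (fun k : L a => ∑ ω, c a k ω * (x ω / p)) (Finset.mem_univ ℓ))
  rw [← sub_nonneg, ← Finset.sum_sub_distrib]
  convert div_nonneg (h a' ℓ') hp using 1
  rw [Finset.sum_div]
  exact Finset.sum_congr rfl fun ω _ => by ring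

/-- **Soundness of the active-facet LP.** Every feasible LP solution `q` induces an
incentive-compatible signaling scheme `π(ω)((a,ℓ)) := q_{a,ℓ,ω}/μ0(ω)` with recommendation
`(a,ℓ) ↦ a`, whose sender value equals the LP objective value of `q`. -/
theorem active_facet_lp_soundness
    (Ω A : Type*) [Fintype Ω] [Fintype A] [Nonempty A]
    (L : A → Type*) [∀ a, Fintype (L a)] [∀ a, Nonempty (L a)]
    (c : (a : A) → L a → Ω → ℝ)
    (μ0 : Ω → ℝ) (hμ0pos : ∀ ω, 0 < μ0 ω) (hμ0sum : ∑ ω, μ0 ω = 1)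
    (v : Ω → A → ℝ)
    (q : (Σ a : A, L a) → Ω → ℝ) (hq : LPFeasible c μ0 q) :
    IsScheme (fun ω (σ : Σ a : A, L a) => q σ ω / μ0 ω) ∧
    IC (maxAffine c) μ0 (fun ω (σ : Σ a : A, L a) => q σ ω / μ0 ω) (fun σ => σ.1) ∧
    senderValue μ0 (fun ω (σ : Σ a : A, L a) => q σ ω / μ0 ω) (fun σ => σ.1) v
      = LPValue v q := by
  obtain ⟨hnonneg, hplaus, hdom⟩ := hq
  have hmass : ∀ ω σ, μ0 ω * (q σ ω / μ0 ω) = q σ ω := fun ω σ =>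
    mul_div_cancel₀ _ (hμ0pos ω).ne'
  refine ⟨⟨fun ω σ => div_nonneg (hnonneg σ ω) (hμ0pos ω).le, fun ω => ?_⟩, ?_, ?_⟩
  · rw [← Finset.sum_div, hplaus, div_self (hμ0pos ω).ne']
  · intro σ hσ a'
    unfold posterior
    simp only [hmass]
    exact maxAffine_div_le_of_dominance c (q σ) hσ.le σ.1 σ.2
      (fun b k => hdom σ ⟨b, k⟩) a'
  · simp only [senderValue, LPValue, hmass]
    exact Finset.sum_comm
end

section
/- Let G be a simple graph on a finite nonempty vertex set V with |V| = n, and let K be a natural number with 1 ≤ K ≤ n. Consider the persuasion instance with state space Ω = V, uniform prior μ0(v) = 1/n, two actions A = {a_T, a_0}, sender payoff v(·, a_T) = 1 and v(·, a_0) = 0, and receiver risk values ρ(μ, a_0) := 1 and ρ(μ, a_T) := the maximum over all K-element cliques C of G of Σ_{v ∈ C} μ(v), taken to be 0 if G has no K-element clique. Then there exists an incentive-compatible signaling scheme with finite signal set whose sender value is at least K/n if and only if G contains a K-element clique. -/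
open Finset

variable {Ω A S : Type*}

/-- Risk value of the target action `a_T`: the maximum of `Σ_{v ∈ C} μ v` over all
`K`-element cliques `C` of `G`, taken to be `0` if `G` has no `K`-element clique. -/
noncomputable def rhoTarget {V : Type*} [Fintype V] [DecidableEq V]
    (G : SimpleGraph V) [DecidableRel G.Adj] (K : ℕ) (μ : V → ℝ) : ℝ :=
  if h : (G.cliqueFinset K).Nonempty then
    (G.cliqueFinset K).sup' h fun C => ∑ v ∈ C, μ v
  else 0

theorem posterior_nonneg [Fintype Ω] {μ0 : Ω → ℝ} {π : Ω → S → ℝ} {s : S}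
    (hμ0 : ∀ ω, 0 ≤ μ0 ω) (hπ : ∀ ω, 0 ≤ π ω s) (ω : Ω) : 0 ≤ posterior μ0 π s ω :=
  div_nonneg (mul_nonneg (hμ0 ω) (hπ ω)) (sum_nonneg fun ω _ => mul_nonneg (hμ0 ω) (hπ ω))

theorem sum_posterior [Fintype Ω] {μ0 : Ω → ℝ} {π : Ω → S → ℝ} {s : S}
    (hs : 0 < sigProb μ0 π s) : ∑ ω, posterior μ0 π s ω = 1 := by
  simp only [posterior, ← sum_div]
  exact div_self hs.ne'

theorem senderValue_eq_sum_sigProb [Fintype Ω] [Fintype S] (μ0 : Ω → ℝ) (π : Ω → S → ℝ)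
    (α : S → A) (u : A → ℝ) :
    senderValue μ0 π α (fun _ => u) = ∑ s, sigProb μ0 π s * u (α s) := by
  simp only [senderValue, sigProb, sum_mul]
  exact sum_comm

section rhoTarget

variable {V : Type*} [Fintype V] [DecidableEq V] {G : SimpleGraph V} [DecidableRel G.Adj]
  {K : ℕ} {μ : V → ℝ}

theorem sum_le_rhoTarget {C : Finset V} (hC : G.IsNClique K C) :
    ∑ v ∈ C, μ v ≤ rhoTarget G K μ := by
  have hmem : C ∈ G.cliqueFinset K := G.mem_cliqueFinset_iff.2 hC
  rw [rhoTarget, dif_pos ⟨C, hmem⟩]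
  exact le_sup' (fun C => ∑ v ∈ C, μ v) hmem

theorem rhoTarget_le_sum (hμ : ∀ v, 0 ≤ μ v) : rhoTarget G K μ ≤ ∑ v, μ v := by
  unfold rhoTarget
  split_ifs with h
  · exact sup'_le h _ fun C _ =>
      sum_le_sum_of_subset_of_nonneg (subset_univ C) fun v _ _ => hμ v
  · exact sum_nonneg fun v _ => hμ v

theorem rhoTarget_eq_zero (h : ¬∃ C : Finset V, G.IsNClique K C) : rhoTarget G K μ = 0 :=
  dif_neg fun ⟨C, hC⟩ => h ⟨C, G.mem_cliqueFinset_iff.1 hC⟩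

end rhoTarget

/-- The scheme revealing whether the state lies in `C`, by the signal `0` inside `C` and `1`
outside. -/
def revealScheme [DecidableEq Ω] (C : Finset Ω) (ω : Ω) (s : Fin 2) : ℝ :=
  if ω ∈ C ↔ s = 0 then 1 else 0

theorem revealScheme_nonneg [DecidableEq Ω] (C : Finset Ω) (ω : Ω) (s : Fin 2) :
    0 ≤ revealScheme C ω s := by
  unfold revealScheme
  split_ifs <;> norm_num

theorem revealScheme_zero [DecidableEq Ω] (C : Finset Ω) (ω : Ω) :
    revealScheme C ω 0 = if ω ∈ C then 1 else 0 := by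
  simp [revealScheme]

theorem isScheme_revealScheme [DecidableEq Ω] (C : Finset Ω) : IsScheme (revealScheme C) := by
  refine ⟨revealScheme_nonneg C, fun ω => ?_⟩
  by_cases h : ω ∈ C <;> simp [revealScheme, Fin.sum_univ_two, h]

theorem sum_posterior_revealScheme [Fintype Ω] [DecidableEq Ω] {μ0 : Ω → ℝ} {C : Finset Ω}
    (h : 0 < sigProb μ0 (revealScheme C) 0) :
    ∑ ω ∈ C, posterior μ0 (revealScheme C) 0 ω = 1 := by
  rw [← sum_posterior h]
  refine sum_subset (subset_univ C) fun ω _ hω => ?_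
  simp [posterior, revealScheme_zero, hω]

/-- **Succinct polyhedral risk and cliques.** With state space the vertices of `G`,
uniform prior `1/n`, two actions (`true` = `a_T`, `false` = `a_0`), sender payoff `1`
for `a_T` and `0` for `a_0`, receiver values `ρ(μ, a_0) = 1` and
`ρ(μ, a_T) = rhoTarget G K μ`: some incentive-compatible finite signaling scheme achieves
sender value at least `K/n` if and only if `G` contains a `K`-element clique. -/
theorem clique_persuasion_value_iff
    (V : Type*) [Fintype V] [Nonempty V] [DecidableEq V]
    (G : SimpleGraph V) [DecidableRel G.Adj]
    (K : ℕ) (hK1 : 1 ≤ K) (hKn : K ≤ Fintype.card V) :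
    (∃ (m : ℕ) (π : V → Fin m → ℝ) (α : Fin m → Bool),
      IsScheme π ∧
      IC (fun μ a => if a then rhoTarget G K μ else 1)
        (fun _ => (1 : ℝ) / Fintype.card V) π α ∧
      (K : ℝ) / Fintype.card V
        ≤ senderValue (fun _ => (1 : ℝ) / Fintype.card V) π α
            (fun _ a => if a then 1 else 0)) ↔
    ∃ C : Finset V, G.IsNClique K C := by
  have hn : (0 : ℝ) < Fintype.card V := Nat.cast_pos.2 Fintype.card_pos
  have hμ0 : ∀ _ : V, (0 : ℝ) ≤ 1 / Fintype.card V := fun _ => by positivity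
  constructor
  · rintro ⟨m, π, α, ⟨hπ, -⟩, hIC, hval⟩
    by_contra hno
    have hzero : senderValue (fun _ : V => (1 : ℝ) / Fintype.card V) π α
        (fun _ a => if a then 1 else 0) ≤ 0 := by
      rw [senderValue_eq_sum_sigProb]
      refine sum_nonpos fun s _ => ?_
      cases hs : α s
      · simp
      · have hsig : ¬0 < sigProb (fun _ : V => (1 : ℝ) / Fintype.card V) π s := fun hpos => by
          have := hIC s hpos false
          norm_num [hs, rhoTarget_eq_zero hno] at this
        simpa using hsig
    have hK : (0 : ℝ) < K := Nat.cast_pos.2 hK1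
    exact absurd (hval.trans hzero) (not_le.2 (by positivity))
  · rintro ⟨C, hC⟩
    refine ⟨2, revealScheme C, fun s => decide (s = 0), isScheme_revealScheme C, ?_, ?_⟩
    · intro s hs a'
      have hle := (rhoTarget_le_sum (G := G) (K := K)
        (posterior_nonneg hμ0 (revealScheme_nonneg C · s))).trans_eq (sum_posterior hs)
      by_cases h0 : s = 0
      · subst h0
        have hge := (sum_posterior_revealScheme hs).symm.trans_le (sum_le_rhoTarget hC)
        cases a'
        · simpa using hge
        · simp
      · cases a'
        · simp [h0]
        · simpa [h0] using hle
    · rw [senderValue_eq_sum_sigProb]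
      simp [sigProb, revealScheme_zero, hC.card_eq, div_eq_mul_inv]
end

section
/- Let Ω be a finite nonempty type, D ≥ 1 a natural number, and g_1, …, g_D : Ω → ℝ statistics with |g_j(ω)| ≤ B for all j and ω, where B > 0. Let μ be a probability vector on Ω and δ > 0. If k is a positive integer with k ≥ (2B²/δ²)·log(2D), then there exists a k-uniform probability vector μ̄ on Ω such that max_{j ∈ {1,…,D}} |Σ_ω g_j(ω)·(μ(ω) − μ̄(ω))| ≤ δ. Consequently, if additionally each action a of a finite action set A has risk value ρ(μ,a) = Ψ_a(Σ_ω g_1(ω)μ(ω), …, Σ_ω g_D(ω)μ(ω)) with Ψ_a : ℝ^D → ℝ Lipschitz with constant L > 0 with respect to the ℓ∞-norm, and δ = ε/L for some ε > 0, then max_{a ∈ A} |ρ(μ,a) − ρ(μ̄,a)| ≤ ε. -/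
open Finset

/-- A probability vector on a finite type. -/
def IsProbVec {Ω : Type*} [Fintype Ω] (μ : Ω → ℝ) : Prop :=
  (∀ ω, 0 ≤ μ ω) ∧ ∑ ω, μ ω = 1

/-- A `k`-uniform vector: every coordinate lies in `{0, 1/k, 2/k, …, 1}`. -/
def IsKUniform {Ω : Type*} (k : ℕ) (μ : Ω → ℝ) : Prop :=
  ∀ ω, ∃ j : ℕ, j ≤ k ∧ μ ω = (j : ℝ) / k

open MeasureTheory ProbabilityTheory in
/-- Hoeffding's lemma for a probability vector on a finite type. -/
theorem IsProbVec.sum_mul_exp_le {Ω : Type*} [Fintype Ω] {μ : Ω → ℝ} (hμ : IsProbVec μ)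
    {f : Ω → ℝ} {B : ℝ} (hf : ∀ ω, |f ω| ≤ B) (t : ℝ) :
    ∑ ω, μ ω * Real.exp (t * (f ω - ∑ ω', μ ω' * f ω')) ≤ Real.exp (t ^ 2 * B ^ 2 / 2) := by
  let _ : MeasurableSpace Ω := ⊤
  let P : Measure Ω := ∑ ω, ENNReal.ofReal (μ ω) • Measure.dirac ω
  have integral_eq (h : Ω → ℝ) : ∫ ω, h ω ∂P = ∑ ω, μ ω * h ω := by
    rw [integral_finsetSum_measure fun _ _ =>
      (integrable_dirac (by finiteness)).smul_measure ENNReal.ofReal_ne_top]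
    simp [integral_smul_measure, ENNReal.toReal_ofReal, hμ.1]
  have : IsProbabilityMeasure P := ⟨by
    simp [P, ← ENNReal.ofReal_sum_of_nonneg fun ω _ => hμ.1 ω, hμ.2]⟩
  have key := (hasSubgaussianMGF_of_mem_Icc (μ := P) (X := f) (a := -B) (b := B)
    (measurable_from_top.aemeasurable) (.of_forall fun ω => abs_le.mp (hf ω))).mgf_le t
  rw [mgf, integral_eq, integral_eq] at key
  refine key.trans_eq ?_
  congr 1
  simp only [NNReal.coe_pow, NNReal.coe_div, coe_nnnorm, NNReal.coe_ofNat, Real.norm_eq_abs,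
    div_pow, sq_abs]
  ring

/-- Some outcome keeps a weighted exponential potential below its average bound. -/
theorem IsProbVec.exists_sum_mul_exp_le {Ω ι : Type*} [Fintype Ω] [Fintype ι] {μ : Ω → ℝ}
    (hμ : IsProbVec μ) {h : ι → Ω → ℝ} {B : ℝ} (hh : ∀ i ω, |h i ω| ≤ B) (t : ℝ)
    {w : ι → ℝ} (hw : ∀ i, 0 ≤ w i) :
    ∃ ω, ∑ i, w i * Real.exp (t * (h i ω - ∑ ω', μ ω' * h i ω')) ≤
      Real.exp (t ^ 2 * B ^ 2 / 2) * ∑ i, w i := by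
  by_contra! hlt
  set C := Real.exp (t ^ 2 * B ^ 2 / 2) * ∑ i, w i with hC
  set F := fun ω => ∑ i, w i * Real.exp (t * (h i ω - ∑ ω', μ ω' * h i ω')) with hF
  have hpos : ∃ ω ∈ univ, 0 < μ ω :=
    exists_lt_of_sum_lt (by simp [hμ.2])
  have hlower : C < ∑ ω, μ ω * F ω := by
    obtain ⟨ω, hω, hpos⟩ := hpos
    calc C = ∑ ω, μ ω * C := by rw [← sum_mul, hμ.2, one_mul]
      _ < ∑ ω, μ ω * F ω := sum_lt_sum
          (fun ω _ => mul_le_mul_of_nonneg_left (hlt ω).le (hμ.1 ω))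
          ⟨ω, hω, mul_lt_mul_of_pos_left (hlt ω) hpos⟩
  have hupper : ∑ ω, μ ω * F ω ≤ C := by
    simp only [hF, mul_sum]
    rw [sum_comm, hC, mul_sum]
    refine sum_le_sum fun i _ => ?_
    simp only [mul_left_comm (μ _), ← mul_sum]
    rw [mul_comm (Real.exp _)]
    exact mul_le_mul_of_nonneg_left (hμ.sum_mul_exp_le (hh i) t) (hw i)
  exact hlower.not_ge hupper

/-- Multiplicities of a sample of size `n` whose exponential potential obeys the
Chernoff–Hoeffding bound. -/
theorem IsProbVec.exists_counts_sum_exp_le {Ω ι : Type*} [Fintype Ω] [Fintype ι] {μ : Ω → ℝ}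
    (hμ : IsProbVec μ) {h : ι → Ω → ℝ} {B : ℝ} (hh : ∀ i ω, |h i ω| ≤ B) (t : ℝ) (n : ℕ) :
    ∃ c : Ω → ℕ, ∑ ω, c ω = n ∧
      ∑ i, Real.exp (t * (∑ ω, c ω * h i ω - n * ∑ ω, μ ω * h i ω)) ≤
        Real.exp (t ^ 2 * B ^ 2 / 2) ^ n * Fintype.card ι := by
  classical
  induction n with
  | zero => exact ⟨0, by simp, by simp⟩
  | succ n ih =>
    obtain ⟨c, hc, hle⟩ := ih
    obtain ⟨ω₀, hω₀⟩ := hμ.exists_sum_mul_exp_le hh t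
      (w := fun i => Real.exp (t * (∑ ω, c ω * h i ω - n * ∑ ω, μ ω * h i ω)))
      fun _ => (Real.exp_pos _).le
    refine ⟨c + Pi.single ω₀ 1, by simp [sum_add_distrib, hc], ?_⟩
    calc _ = _ := sum_congr rfl fun i _ => ?_
      _ ≤ _ := hω₀
      _ ≤ _ := mul_le_mul_of_nonneg_left hle (Real.exp_pos _).le
      _ = _ := by rw [pow_succ']; ring
    rw [← Real.exp_add]
    congr 1
    have hsum : ∑ ω, ((c + Pi.single ω₀ 1 : Ω → ℕ) ω : ℝ) * h i ω =
        ∑ ω, c ω * h i ω + h i ω₀ := by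
      simp [Pi.single_apply, add_mul, sum_add_distrib]
    rw [hsum]
    push_cast
    ring

/-- Every probability vector is matched on finitely many bounded statistics, up to `δ` and from
above, by a `k`-uniform one. -/
theorem IsProbVec.exists_isKUniform_sub_le {Ω ι : Type*} [Fintype Ω] [Fintype ι] [Nonempty ι]
    {μ : Ω → ℝ} (hμ : IsProbVec μ) {h : ι → Ω → ℝ} {B δ : ℝ} (hB : 0 < B) (hδ : 0 < δ)
    (hh : ∀ i ω, |h i ω| ≤ B) {k : ℕ} (hk1 : 1 ≤ k)
    (hk : 2 * B ^ 2 / δ ^ 2 * Real.log (Fintype.card ι) ≤ k) :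
    ∃ ν : Ω → ℝ, IsProbVec ν ∧ IsKUniform k ν ∧
      ∀ i, ∑ ω, h i ω * (ν ω - μ ω) ≤ δ := by
  obtain ⟨c, hc, hle⟩ := hμ.exists_counts_sum_exp_le hh (δ / B ^ 2) k
  have hk0 : (0 : ℝ) < k := by exact_mod_cast hk1
  refine ⟨fun ω => c ω / k, ⟨fun ω => by positivity, ?_⟩,
    fun ω => ⟨c ω, hc ▸ single_le_sum (fun _ _ => Nat.zero_le _) (mem_univ ω), rfl⟩, fun i => ?_⟩
  · rw [← sum_div, ← Nat.cast_sum, hc, div_self hk0.ne']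
  have hcard : (0 : ℝ) < Fintype.card ι := by exact_mod_cast Fintype.card_pos
  have hexp : Real.exp (δ / B ^ 2 * (∑ ω, c ω * h i ω - k * ∑ ω, μ ω * h i ω)) ≤
      Real.exp (k * ((δ / B ^ 2) ^ 2 * B ^ 2 / 2) + Real.log (Fintype.card ι)) := by
    rw [Real.exp_add, Real.exp_log hcard, Real.exp_nat_mul]
    exact (single_le_sum (f := fun i => Real.exp (δ / B ^ 2 *
      (∑ ω, c ω * h i ω - k * ∑ ω, μ ω * h i ω))) (fun _ _ => (Real.exp_pos _).le)
      (mem_univ i)).trans hle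
  have hlog : Real.log (Fintype.card ι) ≤ k * (δ ^ 2 / (2 * B ^ 2)) := by
    rw [← div_le_iff₀ (by positivity), div_div_eq_mul_div, div_le_iff₀ (by positivity)]
    rw [div_mul_eq_mul_div, div_le_iff₀ (by positivity)] at hk
    linarith
  have hdev : δ / B ^ 2 * (∑ ω, c ω * h i ω - k * ∑ ω, μ ω * h i ω) ≤ δ / B ^ 2 * (k * δ) := by
    refine (Real.exp_le_exp.mp hexp).trans ((add_le_add_right hlog _).trans_eq ?_)
    field_simp
    ring
  have hdev := le_of_mul_le_mul_left hdev (by positivity)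
  have hsum : ∑ ω, h i ω * (c ω / k - μ ω) =
      (∑ ω, c ω * h i ω - k * ∑ ω, μ ω * h i ω) / k := by
    rw [mul_sum, ← sum_sub_distrib, sum_div]
    exact sum_congr rfl fun ω _ => by field_simp
  rw [hsum, div_le_iff₀ hk0]
  linarith

/-- **Uniform finite-statistic approximation by `k`-uniform posteriors.**
If `k ≥ (2B²/δ²)·log(2D)`, then any posterior `μ` admits a `k`-uniform posterior `μ̄`
matching all `D` bounded statistics up to `δ`; consequently, if each action's risk value is
an `L`-Lipschitz (ℓ∞) function `Ψ_a` of the statistics and `δ = ε/L`, all risk values are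
matched up to `ε`. -/
theorem kUniform_statistic_approx
    (Ω : Type*) [Fintype Ω] [Nonempty Ω]
    (D : ℕ) (hD : 1 ≤ D)
    (g : Fin D → Ω → ℝ) (B : ℝ) (hB : 0 < B) (hg : ∀ j ω, |g j ω| ≤ B)
    (μ : Ω → ℝ) (hμ : IsProbVec μ)
    (δ : ℝ) (hδ : 0 < δ)
    (k : ℕ) (hk1 : 1 ≤ k) (hk : 2 * B ^ 2 / δ ^ 2 * Real.log (2 * D) ≤ (k : ℝ))
    (A : Type*) [Fintype A]
    (Ψ : A → (Fin D → ℝ) → ℝ) (Lip : ℝ) (hLip0 : 0 < Lip)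
    (hLip : ∀ a, LipschitzWith Lip.toNNReal (Ψ a))
    (ρ : (Ω → ℝ) → A → ℝ)
    (hρ : ∀ (ν : Ω → ℝ) (a : A), ρ ν a = Ψ a fun j => ∑ ω, g j ω * ν ω)
    (ε : ℝ) (hε : δ = ε / Lip) :
    ∃ μbar : Ω → ℝ, IsProbVec μbar ∧ IsKUniform k μbar ∧
      (∀ j : Fin D, |∑ ω, g j ω * (μ ω - μbar ω)| ≤ δ) ∧
      ∀ a : A, |ρ μ a - ρ μbar a| ≤ ε := by
  have : Nonempty (Fin D) := ⟨⟨0, hD⟩⟩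
  obtain ⟨ν, hν, hνk, hdev⟩ := hμ.exists_isKUniform_sub_le (h := Sum.elim g (-g)) hB hδ
    (by rintro (j | j) ω <;> simp [hg]) hk1 (by simpa [two_mul] using hk)
  have hstat (j : Fin D) : |∑ ω, g j ω * (μ ω - ν ω)| ≤ δ := by
    have hpos := hdev (.inl j)
    have hneg := hdev (.inr j)
    simp only [Sum.elim_inl, Sum.elim_inr, Pi.neg_apply, neg_mul, sum_neg_distrib, mul_sub,
      sum_sub_distrib] at hpos hneg ⊢
    exact abs_le.mpr ⟨by linarith, by linarith⟩
  refine ⟨ν, hν, hνk, hstat, fun a => ?_⟩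
  rw [hρ, hρ, ← Real.dist_eq]
  refine ((hLip a).dist_le_mul _ _).trans ?_
  rw [Real.coe_toNNReal _ hLip0.le, ← le_div_iff₀' hLip0, ← hε, dist_pi_le_iff hδ.le]
  intro j
  rw [Real.dist_eq, ← sum_sub_distrib]
  simpa only [mul_sub] using hstat j
end

section
/- Assume the finite-statistic representation with statistics g_1,…,g_D, Lipschitz constant L_Ψ > 0, finite action set A, and tolerance ε_R > 0, and let μ0 be a prior with μ0(ω) > 0 for all ω. Let φ : Ω × Σ̂ → ℝ satisfy: φ(ω,σ) ≥ 0; Σ_{σ ∈ Σ̂} φ(ω,σ) = 1 for every ω; and for every σ = (μ̄_σ, a_σ) ∈ Σ̂ and every j ∈ {1,…,D}, both Σ_ω μ0(ω)φ(ω,σ)·( g_j(ω) − ⟨g_j, μ̄_σ⟩ + ε_R/L_Ψ ) ≥ 0 and Σ_ω μ0(ω)φ(ω,σ)·( g_j(ω) − ⟨g_j, μ̄_σ⟩ − ε_R/L_Ψ ) ≤ 0. Then φ defines a valid signaling scheme, and for every σ = (μ̄_σ, a_σ) ∈ Σ̂ with p_σ := Σ_ω μ0(ω)φ(ω,σ)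 > 0, the induced posterior μ_σ(ω) := μ0(ω)φ(ω,σ)/p_σ satisfies max_{a' ∈ A} ρ(μ_σ, a') − ρ(μ_σ, a_σ) ≤ 4·ε_R. -/
open Finset

/-- If the weights `w` have positive total mass and the `w`-weighted sum of `f` lies within the
`c ± δ` cell, then so does the normalized average of `f`. -/
lemma abs_sum_mul_div_sub_le {Ω : Type*} [Fintype Ω] (w f : Ω → ℝ) (c δ : ℝ)
    (hw : 0 < ∑ ω, w ω) (hlo : 0 ≤ ∑ ω, w ω * (f ω - c + δ))
    (hhi : ∑ ω, w ω * (f ω - c - δ) ≤ 0) :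
    |∑ ω, f ω * (w ω / ∑ ω', w ω') - c| ≤ δ := by
  have havg : ∑ ω, f ω * (w ω / ∑ ω', w ω') = (∑ ω, w ω * f ω) / ∑ ω, w ω := by
    rw [Finset.sum_div]
    exact Finset.sum_congr rfl fun ω _ => by ring
  simp only [mul_add, mul_sub, Finset.sum_add_distrib, Finset.sum_sub_distrib,
    ← Finset.sum_mul] at hlo hhi
  rw [havg, abs_sub_le_iff, sub_le_iff_le_add, sub_le_comm, div_le_iff₀ hw, le_div_iff₀ hw]
  constructor <;> linarith

/-- **Soundness of the state-contingent LP.** Under the finite-statistic representation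
`ρ(μ,a) = Ψ_a(⟨g_1,μ⟩,…,⟨g_D,μ⟩)` with `L_Ψ`-Lipschitz (ℓ∞) maps `Ψ_a`, suppose the
signals `σ` of a finite alphabet carry `k`-uniform probability centers `cen σ` at which the
recommended action `act σ` is `2ε_R`-optimal, and `φ` is feasible for the state-contingent
LP (nonnegative, rows summing to one, statistic-cell constraints with tolerance
`ε_R/L_Ψ`).  Then `φ` is a valid signaling scheme and at every supported signal the
incentive-compatibility regret of the recommended action at the induced posterior is at
most `4·ε_R`. -/
theorem state_contingent_lp_soundness
    (Ω A : Type*) [Fintype Ω] [Nonempty Ω] [Fintype A] [Nonempty A]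
    (D : ℕ) (g : Fin D → Ω → ℝ)
    (LΨ : ℝ) (hLΨ : 0 < LΨ)
    (Ψ : A → (Fin D → ℝ) → ℝ) (hLip : ∀ a, LipschitzWith LΨ.toNNReal (Ψ a))
    (ρ : (Ω → ℝ) → A → ℝ)
    (hρ : ∀ (ν : Ω → ℝ) (a : A), ρ ν a = Ψ a fun j => ∑ ω, g j ω * ν ω)
    (εR : ℝ) (hεR : 0 < εR) (k : ℕ)
    (μ0 : Ω → ℝ) (hμ0pos : ∀ ω, 0 < μ0 ω) (hμ0sum : ∑ ω, μ0 ω = 1)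
    (S : Type*) [Fintype S]
    (cen : S → Ω → ℝ) (act : S → A)
    (hcenProb : ∀ σ, IsProbVec (cen σ)) (hcenUnif : ∀ σ, IsKUniform k (cen σ))
    (hcenOpt : ∀ (σ : S) (a' : A), ρ (cen σ) a' - 2 * εR ≤ ρ (cen σ) (act σ))
    (φ : Ω → S → ℝ)
    (hφ0 : ∀ ω σ, 0 ≤ φ ω σ)
    (hφ1 : ∀ ω, ∑ σ, φ ω σ = 1)
    (hcellLo : ∀ (σ : S) (j : Fin D),
      0 ≤ ∑ ω, μ0 ω * φ ω σ * (g j ω - (∑ ω', g j ω' * cen σ ω') + εR / LΨ))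
    (hcellHi : ∀ (σ : S) (j : Fin D),
      ∑ ω, μ0 ω * φ ω σ * (g j ω - (∑ ω', g j ω' * cen σ ω') - εR / LΨ) ≤ 0) :
    ∀ σ : S, 0 < ∑ ω, μ0 ω * φ ω σ →
      ∀ a' : A,
        ρ (fun ω => μ0 ω * φ ω σ / ∑ ω', μ0 ω' * φ ω' σ) a'
          - ρ (fun ω => μ0 ω * φ ω σ / ∑ ω', μ0 ω' * φ ω' σ) (act σ) ≤ 4 * εR := by
  intro σ hp a'
  set ν : Ω → ℝ := fun ω => μ0 ω * φ ω σ / ∑ ω', μ0 ω' * φ ω' σ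
  have hclose : ∀ a, |ρ ν a - ρ (cen σ) a| ≤ εR := by
    intro a
    have hdist : dist (fun j => ∑ ω, g j ω * ν ω) (fun j => ∑ ω, g j ω * cen σ ω) ≤ εR / LΨ :=
      (dist_pi_le_iff (by positivity)).2 fun j =>
        abs_sum_mul_div_sub_le (fun ω => μ0 ω * φ ω σ) (g j) _ _ hp (hcellLo σ j) (hcellHi σ j)
    rw [hρ, hρ, ← Real.dist_eq]
    calc _ ≤ (LΨ.toNNReal : ℝ) * _ := (hLip a).dist_le_mul _ _
      _ ≤ LΨ * (εR / LΨ) := by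
        rw [Real.coe_toNNReal _ hLΨ.le]
        gcongr
      _ = εR := mul_div_cancel₀ _ hLΨ.ne'
  have h₁ := abs_le.1 (hclose a')
  have h₂ := abs_le.1 (hclose (act σ))
  linarith [hcenOpt σ a']
end

section
/- Let Ω be a finite state space with m = |Ω| elements, and let μ0 be a probability vector on Ω. Let τ be a finitely supported probability distribution over probability vectors on Ω (i.e. finitely many posteriors μ_1,…,μ_J with weights p_1,…,p_J ≥ 0, Σ_j p_j = 1) that is Bayes plausible: Σ_j p_j·μ_j = μ0. Let W be any real-valued function on probability vectors. Then there exists a Bayes-plausible finitely supported distribution τ' whose support is contained in {μ_1,…,μ_J}, whose support has at most m elements, and whose value satisfies Σ_{μ ∈ supp τ'} τ'(μ)·W(μ) ≥ Σ_j p_j·W(μ_j). -/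
open Finset

/-- A family of more than `finrank` vectors, all lying on the positive side of a hyperplane, has a
linear relation that does not decrease a given linear objective and has a negative coefficient. -/
lemma exists_relation_neg_of_finrank_lt_card {ι V : Type*} [AddCommGroup V] [Module ℝ V]
    [FiniteDimensional ℝ V] (v : ι → V) (φ : V →ₗ[ℝ] ℝ) (hφ : ∀ j, 0 < φ (v j)) (w : ι → ℝ)
    (s : Finset ι) (hs : Module.finrank ℝ V < s.card) :
    ∃ c : ι → ℝ, ∑ j ∈ s, c j • v j = 0 ∧ 0 ≤ ∑ j ∈ s, c j * w j ∧ ∃ j ∈ s, c j < 0 := by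
  have hdep : ∃ c : ι → ℝ, ∑ j ∈ s, c j • v j = 0 ∧ ∃ j ∈ s, c j ≠ 0 := by
    rw [← not_linearIndepOn_finset_iff]
    intro hli
    have hle := LinearIndependent.fintype_card_le_finrank hli
    simp only [Finset.coe_sort_coe, Fintype.card_coe] at hle
    omega
  have key : ∀ c : ι → ℝ, ∑ j ∈ s, c j • v j = 0 → (∃ j ∈ s, c j ≠ 0) → ∃ j ∈ s, c j < 0 := by
    intro c hc ⟨i, hi, hci⟩
    by_contra! hnonneg
    have hsum : ∑ j ∈ s, c j * φ (v j) = 0 := by simpa using congrArg φ hc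
    rw [Finset.sum_eq_zero_iff_of_nonneg
      fun j hj => mul_nonneg (hnonneg j hj) (hφ j).le] at hsum
    exact (mul_ne_zero hci (hφ i).ne') (hsum i hi)
  obtain ⟨c, hc, i, hi, hci⟩ := hdep
  rcases le_total 0 (∑ j ∈ s, c j * w j) with h | h
  · exact ⟨c, hc, h, key c hc ⟨i, hi, hci⟩⟩
  · have hneg : ∑ j ∈ s, (-c) j • v j = 0 := by simp [hc]
    exact ⟨-c, hneg, by simpa using h, key (-c) hneg ⟨i, hi, by simpa using hci⟩⟩

/-- If the support of a nonnegative weight is larger than the dimension, the support can be shrunk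
without changing the weighted sum of the vectors or decreasing the objective. -/
lemma exists_reweighting_support_card_lt {ι V : Type*} [Fintype ι] [AddCommGroup V] [Module ℝ V]
    [FiniteDimensional ℝ V] (v : ι → V) (φ : V →ₗ[ℝ] ℝ) (hφ : ∀ j, 0 < φ (v j)) (w p : ι → ℝ)
    (hp : ∀ j, 0 ≤ p j) (hcard : Module.finrank ℝ V < #{j | p j ≠ 0}) :
    ∃ q : ι → ℝ, (∀ j, 0 ≤ q j) ∧ ∑ j, q j • v j = ∑ j, p j • v j ∧
      ∑ j, p j * w j ≤ ∑ j, q j * w j ∧ #{j | q j ≠ 0} < #{j | p j ≠ 0} := by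
  classical
  obtain ⟨c, hc, hw, k, hk, hck⟩ := exists_relation_neg_of_finrank_lt_card v φ hφ w _ hcard
  set s : Finset ι := {j | p j ≠ 0} with hs
  obtain ⟨i, hi, hmin⟩ := (s.filter (c · < 0)).exists_min_image (fun j => p j / -c j)
    ⟨k, Finset.mem_filter.2 ⟨hk, hck⟩⟩
  obtain ⟨his, hci⟩ := Finset.mem_filter.1 hi
  set t := p i / -c i with ht
  have ht0 : 0 ≤ t := div_nonneg (hp i) (by linarith)
  let d : ι → ℝ := fun j => if j ∈ s then c j else 0
  have hdv : ∑ j, d j • v j = 0 := by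
    simpa [d, ite_smul, Finset.sum_ite_mem] using hc
  have hdw : 0 ≤ ∑ j, d j * w j := by
    simpa [d, ite_mul, Finset.sum_ite_mem] using hw
  refine ⟨fun j => p j + t * d j, fun j => ?_, ?_, ?_, ?_⟩
  · by_cases hj : j ∈ s
    · simp only [d, hj, if_true]
      rcases lt_or_ge (c j) 0 with hcj | hcj
      · have := hmin j (Finset.mem_filter.2 ⟨hj, hcj⟩)
        rw [le_div_iff₀ (by linarith)] at this
        linarith
      · exact add_nonneg (hp j) (mul_nonneg ht0 hcj)
    · simpa [d, hj] using hp j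
  · simp only [add_smul, Finset.sum_add_distrib, mul_smul, ← Finset.smul_sum, hdv, smul_zero,
      add_zero]
  · simp only [add_mul, Finset.sum_add_distrib, mul_assoc, ← Finset.mul_sum]
    exact le_add_of_nonneg_right (mul_nonneg ht0 hdw)
  · refine Finset.card_lt_card (Finset.ssubset_iff_of_subset (fun j hj => ?_) |>.2 ⟨i, his, ?_⟩)
    · by_contra hjs
      have hpj : p j = 0 := by simpa [hs] using hjs
      simp [d, hjs, hpj] at hj
    · have : p i + t * c i = 0 := by
        rw [ht]
        field_simp [hci.ne]
        ring
      simp [d, his, this]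

/-- **Conic Carathéodory with an objective.** A nonnegative weight on vectors in an open half-space
can be replaced by one supported on at most `finrank` indices, with the same weighted sum and at
least the same objective value. -/
lemma exists_reweighting_support_card_le_finrank {ι V : Type*} [Fintype ι] [AddCommGroup V]
    [Module ℝ V] [FiniteDimensional ℝ V] (v : ι → V) (φ : V →ₗ[ℝ] ℝ) (hφ : ∀ j, 0 < φ (v j))
    (w p : ι → ℝ) (hp : ∀ j, 0 ≤ p j) :
    ∃ q : ι → ℝ, (∀ j, 0 ≤ q j) ∧ ∑ j, q j • v j = ∑ j, p j • v j ∧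
      ∑ j, p j * w j ≤ ∑ j, q j * w j ∧ #{j | q j ≠ 0} ≤ Module.finrank ℝ V := by
  induction hn : #{j | p j ≠ 0} using Nat.strong_induction_on generalizing p with
  | _ n ih =>
    by_cases hcard : #{j | p j ≠ 0} ≤ Module.finrank ℝ V
    · exact ⟨p, hp, rfl, le_rfl, hcard⟩
    · obtain ⟨q, hq, hqv, hqw, hlt⟩ :=
        exists_reweighting_support_card_lt v φ hφ w p hp (not_le.1 hcard)
      obtain ⟨r, hr, hrv, hrw, hle⟩ := ih _ (hn ▸ hlt) q hq rfl
      exact ⟨r, hr, hrv.trans hqv, hqw.trans hrw, hle⟩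

/-- **Finite posterior support (splitting / Carathéodory reduction).** Given a
Bayes-plausible finitely supported distribution `(p, μ)` over posteriors for the prior
`μ0` and any value function `W` on beliefs, there is a Bayes-plausible reweighting `p'`
of the same posteriors whose support (as a set of probability vectors) has at most
`|Ω|` elements and whose expected value of `W` is at least the original one. -/
theorem finite_posterior_support
    (Ω : Type*) [Fintype Ω]
    (μ0 : Ω → ℝ) (hμ0 : IsProbVec μ0)
    (J : ℕ) (μ : Fin J → Ω → ℝ) (hμ : ∀ j, IsProbVec (μ j))
    (p : Fin J → ℝ) (hp : ∀ j, 0 ≤ p j) (hp1 : ∑ j, p j = 1)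
    (hbayes : ∀ ω, ∑ j, p j * μ j ω = μ0 ω)
    (W : (Ω → ℝ) → ℝ) :
    ∃ p' : Fin J → ℝ,
      (∀ j, 0 ≤ p' j) ∧ (∑ j, p' j = 1) ∧
      (∀ ω, ∑ j, p' j * μ j ω = μ0 ω) ∧
      {ν : Ω → ℝ | ∃ j, p' j ≠ 0 ∧ ν = μ j}.ncard ≤ Fintype.card Ω ∧
      ∑ j, p j * W (μ j) ≤ ∑ j, p' j * W (μ j) := by
  classical
  let φ : (Ω → ℝ) →ₗ[ℝ] ℝ := ∑ ω, LinearMap.proj ω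
  have hφ : ∀ j, φ (μ j) = 1 := fun j => by simpa [φ] using (hμ j).2
  obtain ⟨q, hq, hqv, hqw, hcard⟩ := exists_reweighting_support_card_le_finrank μ φ
    (fun j => by simp [hφ]) (fun j => W (μ j)) p hp
  refine ⟨q, hq, ?_, fun ω => ?_, ?_, hqw⟩
  · simpa [hφ, hp1] using congrArg φ hqv
  · rw [← hbayes]
    simpa using congrFun hqv ω
  · have himage : {ν : Ω → ℝ | ∃ j, q j ≠ 0 ∧ ν = μ j} =
        ↑(({j | q j ≠ 0} : Finset (Fin J)).image μ) := by
      ext ν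
      simp [eq_comm]
    rw [himage, Set.ncard_coe_finset]
    exact Finset.card_image_le.trans (by simpa using hcard)
end
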